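/- arXiv:0811.2449 — 2 statements merged into one kernel-verified Lean document; each statement's English description precedes it below -/
import Mathlib

section
/- Given any five points in a triangle of unit area, there exist three of them that form a triangle (possibly degenerate) of area at most 1/4. -/
open MeasureTheory

noncomputable def triArea (p q r : EuclideanSpace ℝ (Fin 2)) : ℝ :=
  (volume (convexHull ℝ ({p, q, r} : Set (EuclideanSpace ℝ (Fin 2))))).toReal

/-- The affine determinant of three points, i.e. twice the signed area of their triangle. -/
noncomputable def planarDet (p q r : EuclideanSpace ℝ (Fin 2)) : ℝ :=
  (q 0 - p 0) * (r 1 - p 1) - (q 1 - p 1) * (r 0 - p 0)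

theorem triArea_eq (p q r : EuclideanSpace ℝ (Fin 2)) :
    triArea p q r = |planarDet p q r| * triArea 0 !₂[1, 0] !₂[0, 1] := by
  set L : EuclideanSpace ℝ (Fin 2) →ₗ[ℝ] EuclideanSpace ℝ (Fin 2) :=
    Matrix.toLpLin 2 2 !![q 0 - p 0, r 0 - p 0; q 1 - p 1, r 1 - p 1] with hL
  have hdet : LinearMap.det L = planarDet p q r := by
    rw [hL, Matrix.toLpLin_eq_toLin, LinearMap.det_toLin, Matrix.det_fin_two_of, planarDet]
    ring
  have hset : convexHull ℝ {p, q, r} =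
      (fun x => p + x) '' (L '' convexHull ℝ {0, !₂[1, 0], !₂[0, 1]}) := by
    have htrans := (AffineEquiv.constVAdd ℝ (EuclideanSpace ℝ (Fin 2))
      p).toAffineMap.image_convexHull
      (L '' {0, !₂[1, 0], !₂[0, 1]})
    rw [LinearMap.image_convexHull]
    refine Eq.trans ?_ htrans.symm
    congr 1
    have h1 : p + L !₂[1, 0] = q := by
      ext i; fin_cases i <;> simp [hL, Matrix.toLpLin_apply]
    have h2 : p + L !₂[0, 1] = r := by
      ext i; fin_cases i <;> simp [hL, Matrix.toLpLin_apply]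
    simp [Set.image_insert_eq, h1, h2]
  unfold triArea
  rw [hset, Set.image_add_left, measure_preimage_add, Measure.addHaar_image_linearMap, hdet,
    ENNReal.toReal_mul, ENNReal.toReal_ofReal (abs_nonneg _)]

/-- The determinant of three coordinate vectors. -/
def baryDet (a b c : Fin 3 → ℝ) : ℝ :=
  a 0 * (b 1 * c 2 - b 2 * c 1) - a 1 * (b 0 * c 2 - b 2 * c 0) + a 2 * (b 0 * c 1 - b 1 * c 0)

theorem baryDet_rotate (a b c : Fin 3 → ℝ) : baryDet b c a = baryDet a b c := by
  unfold baryDet; ring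

theorem baryDet_swap (a b c : Fin 3 → ℝ) : baryDet b a c = -baryDet a b c := by
  unfold baryDet; ring

theorem baryDet_swap_right (a b c : Fin 3 → ℝ) : baryDet a c b = -baryDet a b c := by
  unfold baryDet; ring

theorem sum_eq_one_of_mem_stdSimplex {a : Fin 3 → ℝ} (ha : a ∈ stdSimplex ℝ (Fin 3)) :
    a 0 + a 1 + a 2 = 1 := by
  simpa [Fin.sum_univ_three] using ha.2

theorem baryDet_four_term {a b c d : Fin 3 → ℝ} (ha : a ∈ stdSimplex ℝ (Fin 3))
    (hb : b ∈ stdSimplex ℝ (Fin 3)) (hc : c ∈ stdSimplex ℝ (Fin 3))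
    (hd : d ∈ stdSimplex ℝ (Fin 3)) :
    baryDet b c d + baryDet a b d = baryDet a c d + baryDet a b c := by
  have ea : a 2 = 1 - a 0 - a 1 := by linarith [sum_eq_one_of_mem_stdSimplex ha]
  have eb : b 2 = 1 - b 0 - b 1 := by linarith [sum_eq_one_of_mem_stdSimplex hb]
  have ec : c 2 = 1 - c 0 - c 1 := by linarith [sum_eq_one_of_mem_stdSimplex hc]
  have ed : d 2 = 1 - d 0 - d 1 := by linarith [sum_eq_one_of_mem_stdSimplex hd]
  unfold baryDet
  rw [ea, eb, ec, ed]
  ring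

theorem baryDet_cramer (a b c d : Fin 3 → ℝ) (i : Fin 3) :
    baryDet b c d * a i + baryDet a b d * c i = baryDet a c d * b i + baryDet a b c * d i := by
  fin_cases i <;> simp only [baryDet, Fin.zero_eta, Fin.mk_one, Fin.reduceFinMk] <;> ring

theorem baryDet_le_one {a b c : Fin 3 → ℝ} (ha : a ∈ stdSimplex ℝ (Fin 3))
    (hb : b ∈ stdSimplex ℝ (Fin 3)) (hc : c ∈ stdSimplex ℝ (Fin 3)) : baryDet a b c ≤ 1 := by
  have h : (a 0 + a 1 + a 2) * (b 0 + b 1 + b 2) * (c 0 + c 1 + c 2) = 1 := by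
    simp [sum_eq_one_of_mem_stdSimplex, ha, hb, hc]
  have hm : ∀ i j k, 0 ≤ a i * b j * c k := fun i j k =>
    mul_nonneg (mul_nonneg (ha.1 i) (hb.1 j)) (hc.1 k)
  rw [← h, ← sub_nonneg]
  have e : (a 0 + a 1 + a 2) * (b 0 + b 1 + b 2) * (c 0 + c 1 + c 2) - baryDet a b c
      = a 0 * b 0 * c 0 + a 0 * b 0 * c 1 + a 0 * b 0 * c 2 + a 0 * b 1 * c 0 + a 0 * b 1 * c 1
      + a 0 * b 2 * c 0 + 2 * (a 0 * b 2 * c 1) + a 0 * b 2 * c 2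
      + a 1 * b 0 * c 0 + a 1 * b 0 * c 1 + 2 * (a 1 * b 0 * c 2)
      + a 1 * b 1 * c 0 + a 1 * b 1 * c 1 + a 1 * b 1 * c 2
      + a 1 * b 2 * c 1 + a 1 * b 2 * c 2
      + a 2 * b 0 * c 0 + a 2 * b 0 * c 2 + 2 * (a 2 * b 1 * c 0) + a 2 * b 1 * c 1
      + a 2 * b 1 * c 2 + a 2 * b 2 * c 0 + a 2 * b 2 * c 1 + a 2 * b 2 * c 2 := by
    unfold baryDet; ring
  rw [e]
  linarith [hm 0 0 0, hm 0 0 1, hm 0 0 2, hm 0 1 0, hm 0 1 1, hm 0 2 0, hm 0 2 1, hm 0 2 2,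
    hm 1 0 0, hm 1 0 1, hm 1 0 2, hm 1 1 0, hm 1 1 1, hm 1 1 2, hm 1 2 1, hm 1 2 2,
    hm 2 0 0, hm 2 0 2, hm 2 1 0, hm 2 1 1, hm 2 1 2, hm 2 2 0, hm 2 2 1, hm 2 2 2]

theorem abs_add_abs_le_of_nonneg {b u v : ℝ} (h : 0 ≤ b) (hu : 0 ≤ b + u) (hv : 0 ≤ b + v)
    (huv : 0 ≤ b + u + v) : |u| + |v| ≤ 2 * b + u + v := by
  rcases abs_cases u with ⟨h1, _⟩ | ⟨h1, _⟩ <;> rcases abs_cases v with ⟨h2, _⟩ | ⟨h2, _⟩ <;>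
    rw [h1, h2] <;> linarith

/-- If `y` and `z` have the same sign, `|y| + |z|` is half the `ℓ¹` norm of `(-(y + z), y, z)`. -/
theorem mul_sub_mul_le_of_mul_nonneg {y z y' z' : ℝ} (h : 0 ≤ y * z) :
    y * z' - z * y' ≤ (|y + z| + |y| + |z|) * (|y' + z'| + |y'| + |z'|) / 4 := by
  have e : |y + z| = |y| + |z| := by
    rw [abs_add_eq_add_abs_iff]
    exact mul_nonneg_iff.mp h
  have h1 : y * z' ≤ |y| * |z'| := by rw [← abs_mul]; exact le_abs_self _
  have h2 : -(z * y') ≤ |z| * |y'| := by rw [← abs_mul]; exact neg_le_abs _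
  have h3 : |z'| ≤ |y' + z'| + |y'| := by
    simpa using abs_sub (y' + z') y'
  have h4 : |y'| ≤ |y' + z'| + |z'| := by
    simpa using abs_sub (y' + z') z'
  rw [e]
  nlinarith [mul_nonneg (abs_nonneg y) (sub_nonneg.2 h3),
    mul_nonneg (abs_nonneg z) (sub_nonneg.2 h4)]

theorem mul_sub_mul_le_of_sum_eq_zero {x y z x' y' z' : ℝ} (h : x + y + z = 0)
    (h' : x' + y' + z' = 0) :
    x * y' - y * x' ≤ (|x| + |y| + |z|) * (|x'| + |y'| + |z'|) / 4 := by
  have hx : |y + z| = |x| := by rw [← abs_neg x]; congr 1; linarith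
  have hy : |z + x| = |y| := by rw [← abs_neg y]; congr 1; linarith
  have hz : |x + y| = |z| := by rw [← abs_neg z]; congr 1; linarith
  have hx' : |y' + z'| = |x'| := by rw [← abs_neg x']; congr 1; linarith
  have hy' : |z' + x'| = |y'| := by rw [← abs_neg y']; congr 1; linarith
  have hz' : |x' + y'| = |z'| := by rw [← abs_neg z']; congr 1; linarith
  have ez : z = -x - y := by linarith
  have ez' : z' = -x' - y' := by linarith
  have hs : 0 ≤ x * y ∨ 0 ≤ y * z ∨ 0 ≤ z * x := by
    by_contra! hcon
    obtain ⟨h1, h2, h3⟩ := hcon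
    rcases lt_trichotomy x 0 with hx | hx | hx
    · nlinarith [pos_of_mul_neg_right h1 hx.le, pos_of_mul_neg_left h3 hx.le]
    · simp [hx] at h1
    · nlinarith [neg_of_mul_neg_right h1 hx.le, neg_of_mul_neg_left h3 hx.le]
  rcases hs with hs | hs | hs
  · have := mul_sub_mul_le_of_mul_nonneg (y' := x') (z' := y') hs
    rw [hz, hz'] at this
    linarith
  · have := mul_sub_mul_le_of_mul_nonneg (y' := y') (z' := z') hs
    rw [hx, hx'] at this
    have e : x * y' - y * x' = y * z' - z * y' := by rw [ez, ez']; ring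
    linarith
  · have := mul_sub_mul_le_of_mul_nonneg (y' := z') (z' := x') hs
    rw [hy, hy'] at this
    have e : x * y' - y * x' = z * x' - x * z' := by rw [ez, ez']; ring
    linarith

/-- A triangle that is half of a parallelogram contained in the simplex has relative area
at most `1 / 4`. -/
theorem baryDet_le_of_parallelogram {a b c : Fin 3 → ℝ} (ha : a ∈ stdSimplex ℝ (Fin 3))
    (hb : b ∈ stdSimplex ℝ (Fin 3)) (hc : c ∈ stdSimplex ℝ (Fin 3))
    (h : ∀ i, 0 ≤ a i + c i - b i) : baryDet a b c ≤ 1 / 4 := by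
  have sa := sum_eq_one_of_mem_stdSimplex ha
  have sb := sum_eq_one_of_mem_stdSimplex hb
  have sc := sum_eq_one_of_mem_stdSimplex hc
  have hi : ∀ i, |c i - b i| + |a i - b i| ≤ 2 * b i + (c i - b i) + (a i - b i) := fun i =>
    abs_add_abs_le_of_nonneg (hb.1 i) (by linarith [hc.1 i]) (by linarith [ha.1 i])
      (by linarith [h i])
  have key := mul_sub_mul_le_of_sum_eq_zero (x := c 0 - b 0) (y := c 1 - b 1) (z := c 2 - b 2)
    (x' := a 0 - b 0) (y' := a 1 - b 1) (z' := a 2 - b 2) (by linarith) (by linarith)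
  have e : baryDet a b c = (c 0 - b 0) * (a 1 - b 1) - (c 1 - b 1) * (a 0 - b 0) := by
    have ea : a 2 = 1 - a 0 - a 1 := by linarith
    have eb : b 2 = 1 - b 0 - b 1 := by linarith
    have ec : c 2 = 1 - c 0 - c 1 := by linarith
    unfold baryDet
    rw [ea, eb, ec]
    ring
  set S := |c 0 - b 0| + |c 1 - b 1| + |c 2 - b 2| with hS
  set T := |a 0 - b 0| + |a 1 - b 1| + |a 2 - b 2| with hT
  have hST : S + T ≤ 2 := by linarith [hi 0, hi 1, hi 2]
  have hS0 : 0 ≤ S := by positivity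
  have hT0 : 0 ≤ T := by positivity
  rw [e]
  nlinarith [sq_nonneg (S - T)]

theorem baryDet_le_of_convex_of_le {a b c d : Fin 3 → ℝ} (ha : a ∈ stdSimplex ℝ (Fin 3))
    (hb : b ∈ stdSimplex ℝ (Fin 3)) (hc : c ∈ stdSimplex ℝ (Fin 3))
    (hd : d ∈ stdSimplex ℝ (Fin 3)) (h0 : 0 < baryDet a b c) (h1 : baryDet a b c ≤ baryDet b c d)
    (h2 : baryDet a b c ≤ baryDet a c d) (h3 : baryDet a b c ≤ baryDet a b d) :
    baryDet a b c ≤ 1 / 4 := by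
  refine baryDet_le_of_parallelogram ha hb hc fun i => ?_
  have hsum := baryDet_four_term ha hb hc hd
  have e : baryDet a c d * (a i + c i - b i) = (baryDet a b d - baryDet a b c) * a i
      + (baryDet b c d - baryDet a b c) * c i + baryDet a b c * d i := by
    linear_combination (a i + c i) * -hsum + baryDet_cramer a b c d i
  have hpos : 0 < baryDet a c d := by linarith
  refine nonneg_of_mul_nonneg_right (?_ : 0 ≤ baryDet a c d * (a i + c i - b i)) hpos
  rw [e]
  have := mul_nonneg (sub_nonneg.2 h3) (ha.1 i)
  have := mul_nonneg (sub_nonneg.2 h1) (hc.1 i)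
  have := mul_nonneg h0.le (hd.1 i)
  linarith

/-- A convex quadrilateral in the simplex has three vertices spanning relative area at most
`1 / 4`. -/
theorem not_forall_lt_baryDet_of_convex {a b c d : Fin 3 → ℝ} (ha : a ∈ stdSimplex ℝ (Fin 3))
    (hb : b ∈ stdSimplex ℝ (Fin 3)) (hc : c ∈ stdSimplex ℝ (Fin 3))
    (hd : d ∈ stdSimplex ℝ (Fin 3)) (h1 : 1 / 4 < baryDet a b c) (h2 : 1 / 4 < baryDet b c d)
    (h3 : 1 / 4 < baryDet a c d) (h4 : 1 / 4 < baryDet a b d) : False := by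
  have k1 := baryDet_le_of_convex_of_le ha hb hc hd
  have k2 := baryDet_le_of_convex_of_le hb hc hd ha
  have k3 := baryDet_le_of_convex_of_le hc hd ha hb
  have k4 := baryDet_le_of_convex_of_le hd ha hb hc
  have e1 := baryDet_rotate a b c
  have e2 := baryDet_rotate b c a
  have e3 := baryDet_rotate b c d
  have e4 := baryDet_rotate c d b
  have e5 := baryDet_rotate a c d
  have e6 := baryDet_rotate c d a
  have e7 := baryDet_rotate a b d
  have e8 := baryDet_rotate b d a
  grind

/-- The point `d` lies in the interior of the triangle `a b c`. -/
def IsInside (d a b c : Fin 3 → ℝ) : Prop :=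
  (0 < baryDet d b c ∧ 0 < baryDet a d c ∧ 0 < baryDet a b d) ∨
    (baryDet d b c < 0 ∧ baryDet a d c < 0 ∧ baryDet a b d < 0)

theorem IsInside.rotate {d a b c : Fin 3 → ℝ} (h : IsInside d a b c) : IsInside d b c a := by
  unfold IsInside at *
  rw [baryDet_rotate a d c, baryDet_rotate a b d, baryDet_rotate d b c]
  grind

theorem exists_isInside {a b c d : Fin 3 → ℝ} (ha : a ∈ stdSimplex ℝ (Fin 3))
    (hb : b ∈ stdSimplex ℝ (Fin 3)) (hc : c ∈ stdSimplex ℝ (Fin 3))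
    (hd : d ∈ stdSimplex ℝ (Fin 3)) (h1 : 1 / 4 < |baryDet a b c|) (h2 : 1 / 4 < |baryDet b c d|)
    (h3 : 1 / 4 < |baryDet a c d|) (h4 : 1 / 4 < |baryDet a b d|) :
    IsInside d a b c ∨ IsInside a d b c ∨ IsInside b d c a ∨ IsInside c d a b := by
  have hsum := baryDet_four_term ha hb hc hd
  have k1 := not_forall_lt_baryDet_of_convex ha hb hc hd
  have k2 := not_forall_lt_baryDet_of_convex hd hc hb ha
  have k3 := not_forall_lt_baryDet_of_convex ha hd hb hc
  have k4 := not_forall_lt_baryDet_of_convex hc hb hd ha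
  have k5 := not_forall_lt_baryDet_of_convex ha hb hd hc
  have k6 := not_forall_lt_baryDet_of_convex hc hd hb ha
  have p : ∀ x y z, baryDet y z x = baryDet x y z ∧ baryDet y x z = -baryDet x y z ∧
      baryDet x z y = -baryDet x y z ∧ baryDet z x y = baryDet x y z ∧
      baryDet z y x = -baryDet x y z := by
    intro x y z
    unfold baryDet
    refine ⟨?_, ?_, ?_, ?_, ?_⟩ <;> ring
  obtain ⟨p11, _, _, p14, p15⟩ := p a b c
  obtain ⟨p21, p22, p23, p24, p25⟩ := p b c d
  obtain ⟨p31, _, p33, p34, p35⟩ := p a c d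
  obtain ⟨p41, _, p43, _, p45⟩ := p a b d
  simp only [p15, p21, p22, p23, p24, p25, p31, p33, p35, p41, p43, p45] at k1 k2 k3 k4 k5 k6
  simp only [IsInside, p11, p14, p24, p25, p33, p34, p45]
  rw [lt_abs] at h1 h2 h3 h4
  grind

theorem IsInside.trans {a b c d e : Fin 3 → ℝ} (h : IsInside d a b c) (h' : IsInside a e b c)
    (ha : a ∈ stdSimplex ℝ (Fin 3)) (hb : b ∈ stdSimplex ℝ (Fin 3))
    (hc : c ∈ stdSimplex ℝ (Fin 3)) (hd : d ∈ stdSimplex ℝ (Fin 3))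
    (he : e ∈ stdSimplex ℝ (Fin 3)) : IsInside d e b c := by
  have hS := baryDet_four_term he ha hb hc
  have e1 : baryDet a b c * baryDet e d c =
      baryDet d b c * baryDet e a c + baryDet a d c * baryDet e b c := by
    unfold baryDet; ring
  have e2 : baryDet a b c * baryDet e b d =
      baryDet d b c * baryDet e b a + baryDet a b d * baryDet e b c := by
    unfold baryDet; ring
  have hsum := baryDet_four_term ha hb hc hd
  rw [baryDet_rotate d b c, baryDet_swap_right a d c] at hsum
  have e3 := baryDet_swap_right e a b
  unfold IsInside at *
  rcases h with ⟨h1, h2, h3⟩ | ⟨h1, h2, h3⟩ <;> rcases h' with ⟨k1, k2, k3⟩ | ⟨k1, k2, k3⟩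
  · left
    have hp : 0 < baryDet e b c := by linarith
    exact ⟨h1, pos_of_mul_pos_right (a := baryDet a b c) (by rw [e1]; positivity) k1.le,
      pos_of_mul_pos_right (a := baryDet a b c) (by rw [e2]; positivity) k1.le⟩
  · linarith
  · linarith
  · right
    have hp : baryDet e b c < 0 := by linarith
    refine ⟨h1, ?_, ?_⟩
    · nlinarith [mul_pos_of_neg_of_neg h1 k2, mul_pos_of_neg_of_neg h2 hp]
    · nlinarith [mul_pos_of_neg_of_neg h1 k3, mul_pos_of_neg_of_neg h3 hp]

theorem false_of_lt_of_sum_le_one {S x y z x' y' z' T : ℝ} (hS : S ≤ 1) (h : x + y + z = S)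
    (h' : x' + y' + z' = S) (hx : 1 / 4 < x) (hy : 1 / 4 < y) (hz : 1 / 4 < z) (hx' : 1 / 4 < x')
    (hy' : 1 / 4 < y') (hz' : 1 / 4 < z') (hT : 1 / 4 < |T|) (hTS : T * S = y * z' - z * y') :
    False := by
  have hb : ∀ {s t s' t' : ℝ}, 1 / 4 < s → 1 / 4 < t → 1 / 4 < s' → 1 / 4 < t' →
      s + t < S - 1 / 4 → s' + t' < S - 1 / 4 → s * t' - t * s' ≤ S / 4 := by
    intro s t s' t' _ _ _ _ _ _
    have h1 : s * t' ≤ (S - 1 / 2) * (S - 1 / 2) := by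
      apply mul_le_mul <;> linarith
    have h2 : 1 / 4 * (1 / 4) ≤ t * s' := by
      apply mul_le_mul <;> linarith
    nlinarith
  have h1 := hb hy hz hy' hz' (by linarith) (by linarith)
  have h2 := hb hz hy hz' hy' (by linarith) (by linarith)
  rcases lt_abs.1 hT with h3 | h3 <;> nlinarith

/-- Two points inside a triangle cannot both span only large triangles. -/
theorem not_isInside_and_isInside {a b c d e : Fin 3 → ℝ} (ha : a ∈ stdSimplex ℝ (Fin 3))
    (hb : b ∈ stdSimplex ℝ (Fin 3)) (hc : c ∈ stdSimplex ℝ (Fin 3))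
    (hd : d ∈ stdSimplex ℝ (Fin 3)) (he : e ∈ stdSimplex ℝ (Fin 3)) (h : IsInside d a b c)
    (h' : IsInside e a b c) (h1 : 1 / 4 < |baryDet d b c|) (h2 : 1 / 4 < |baryDet a d c|)
    (h3 : 1 / 4 < |baryDet a b d|) (h1' : 1 / 4 < |baryDet e b c|)
    (h2' : 1 / 4 < |baryDet a e c|) (h3' : 1 / 4 < |baryDet a b e|)
    (hT : 1 / 4 < |baryDet a d e|) : False := by
  have hle := baryDet_le_one ha hb hc
  have hge := baryDet_le_one hb ha hc
  rw [baryDet_swap] at hge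
  have hs := baryDet_four_term ha hb hc hd
  have hs' := baryDet_four_term ha hb hc he
  rw [baryDet_rotate d b c, baryDet_swap_right a d c] at hs
  rw [baryDet_rotate e b c, baryDet_swap_right a e c] at hs'
  have hTS : baryDet a d e * baryDet a b c =
      baryDet a d c * baryDet a b e - baryDet a b d * baryDet a e c := by
    unfold baryDet; ring
  rw [lt_abs] at h1 h2 h3 h1' h2' h3'
  rcases h with ⟨_, _, _⟩ | ⟨_, _, _⟩ <;> rcases h' with ⟨_, _, _⟩ | ⟨_, _, _⟩
  · exact false_of_lt_of_sum_le_one (x := baryDet d b c) (x' := baryDet e b c) hle (by linarith)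
      (by linarith) (by grind) (by grind) (by grind) (by grind) (by grind) (by grind) hT hTS
  · linarith
  · linarith
  · rw [← abs_neg] at hT
    exact false_of_lt_of_sum_le_one (S := -baryDet a b c) (x := -baryDet d b c)
      (y := -baryDet a d c) (z := -baryDet a b d) (x' := -baryDet e b c) (y' := -baryDet a e c)
      (z' := -baryDet a b e) hge (by linarith) (by linarith) (by grind) (by grind) (by grind)
      (by grind) (by grind) (by grind) hT (by linarith)

theorem exists_abs_baryDet_le (w : Fin 5 → Fin 3 → ℝ) (hw : ∀ i, w i ∈ stdSimplex ℝ (Fin 3)) :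
    ∃ i j k : Fin 5, i ≠ j ∧ i ≠ k ∧ j ≠ k ∧ |baryDet (w i) (w j) (w k)| ≤ 1 / 4 := by
  by_contra! h
  have two_inside : ∀ i j k l m : Fin 5, [i, j, k, l, m].Nodup →
      IsInside (w l) (w i) (w j) (w k) → IsInside (w m) (w i) (w j) (w k) → False := by
    intro i j k l m hn hl hm
    simp only [List.nodup_cons, List.mem_cons, not_or, List.not_mem_nil] at hn
    apply not_isInside_and_isInside (hw i) (hw j) (hw k) (hw l) (hw m) hl hm <;> apply h <;> grind
  have one_inside : ∀ i j k l m : Fin 5, [i, j, k, l, m].Nodup →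
      IsInside (w l) (w i) (w j) (w k) → False := by
    intro i j k l m hn hl
    have hn' := hn
    simp only [List.nodup_cons, List.mem_cons, not_or, List.not_mem_nil] at hn'
    have hn1 : [m, j, k, l, i].Nodup := by
      simp only [List.nodup_cons, List.mem_cons, not_or, List.not_mem_nil]
      clear hn; grind
    have hn2 : [m, k, i, l, j].Nodup := by
      simp only [List.nodup_cons, List.mem_cons, not_or, List.not_mem_nil]
      clear hn; grind
    have hn3 : [m, i, j, l, k].Nodup := by
      simp only [List.nodup_cons, List.mem_cons, not_or, List.not_mem_nil]
      clear hn; grind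
    rcases exists_isInside (hw i) (hw j) (hw k) (hw m) (h i j k (by grind) (by grind) (by grind))
      (h j k m (by grind) (by grind) (by grind)) (h i k m (by grind) (by grind) (by grind))
      (h i j m (by grind) (by grind) (by grind)) with hm | hi | hj | hk
    · exact two_inside i j k l m hn hl hm
    · exact two_inside m j k l i hn1 (hl.trans hi (hw i) (hw j) (hw k) (hw l) (hw m)) hi
    · exact two_inside m k i l j hn2
        (hl.rotate.trans hj (hw j) (hw k) (hw i) (hw l) (hw m)) hj
    · exact two_inside m i j l k hn3
        (hl.rotate.rotate.trans hk (hw k) (hw i) (hw j) (hw l) (hw m)) hk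
  rcases exists_isInside (hw 0) (hw 1) (hw 2) (hw 3) (h 0 1 2 (by decide) (by decide) (by decide))
      (h 1 2 3 (by decide) (by decide) (by decide)) (h 0 2 3 (by decide) (by decide) (by decide))
      (h 0 1 3 (by decide) (by decide) (by decide)) with h' | h' | h' | h'
  · exact one_inside 0 1 2 3 4 (by decide) h'
  · exact one_inside 3 1 2 0 4 (by decide) h'
  · exact one_inside 3 2 0 1 4 (by decide) h'
  · exact one_inside 3 0 1 2 4 (by decide) h'

theorem exists_mem_stdSimplex_of_mem_convexHull {A B C x : EuclideanSpace ℝ (Fin 2)}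
    (hx : x ∈ convexHull ℝ {A, B, C}) :
    ∃ w ∈ stdSimplex ℝ (Fin 3), x = w 0 • A + w 1 • B + w 2 • C := by
  rw [convexHull_insert (by simp), convexHull_pair, mem_convexJoin] at hx
  obtain ⟨_, rfl, y, ⟨s, t, hs, ht, hst, rfl⟩, u, v, hu, hv, huv, rfl⟩ := hx
  refine ⟨![u, v * s, v * t], ⟨fun i => ?_, ?_⟩, ?_⟩
  · fin_cases i <;> simp <;> positivity
  · simp only [Fin.sum_univ_three, Matrix.cons_val]
    linear_combination huv + v * hst
  · simp [smul_smul, add_assoc]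

theorem planarDet_combination (A B C : EuclideanSpace ℝ (Fin 2)) {u v w : Fin 3 → ℝ}
    (hu : u ∈ stdSimplex ℝ (Fin 3)) (hv : v ∈ stdSimplex ℝ (Fin 3))
    (hw : w ∈ stdSimplex ℝ (Fin 3)) :
    planarDet (u 0 • A + u 1 • B + u 2 • C) (v 0 • A + v 1 • B + v 2 • C)
      (w 0 • A + w 1 • B + w 2 • C) = baryDet u v w * planarDet A B C := by
  have eu : u 2 = 1 - u 0 - u 1 := by linarith [sum_eq_one_of_mem_stdSimplex hu]
  have ev : v 2 = 1 - v 0 - v 1 := by linarith [sum_eq_one_of_mem_stdSimplex hv]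
  have ew : w 2 = 1 - w 0 - w 1 := by linarith [sum_eq_one_of_mem_stdSimplex hw]
  simp only [planarDet, baryDet, PiLp.add_apply, PiLp.smul_apply, smul_eq_mul, eu, ev, ew]
  ring

theorem stmt_0 (A B C : EuclideanSpace ℝ (Fin 2)) (hABC : triArea A B C = 1)
    (p : Fin 5 → EuclideanSpace ℝ (Fin 2))
    (hp : ∀ i, p i ∈ convexHull ℝ ({A, B, C} : Set (EuclideanSpace ℝ (Fin 2)))) :
    ∃ i j k : Fin 5, i ≠ j ∧ i ≠ k ∧ j ≠ k ∧ triArea (p i) (p j) (p k) ≤ 1 / 4 := by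
  choose w hw hpw using fun i => exists_mem_stdSimplex_of_mem_convexHull (hp i)
  obtain ⟨i, j, k, hij, hik, hjk, h⟩ := exists_abs_baryDet_le w hw
  refine ⟨i, j, k, hij, hik, hjk, ?_⟩
  rw [triArea_eq] at hABC ⊢
  rw [hpw i, hpw j, hpw k, planarDet_combination A B C (hw i) (hw j) (hw k), abs_mul, mul_assoc,
    hABC, mul_one]
  exact h
end

section
/- Given any five points in a triangle of unit area, there exist three of them that form a triangle (possibly degenerate) of area at most 6/25. -/
open MeasureTheory

/-- Twice the signed area of the triangle with vertices `(x₁, y₁)`, `(x₂, y₂)`, `(x₃, y₃)`. -/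
def crossDet (x₁ y₁ x₂ y₂ x₃ y₃ : ℝ) : ℝ :=
  (x₂ - x₁) * (y₃ - y₁) - (x₃ - x₁) * (y₂ - y₁)

lemma triArea_eq_abs_crossDet_mul (p q r : EuclideanSpace ℝ (Fin 2)) :
    triArea p q r = |crossDet (p 0) (p 1) (q 0) (q 1) (r 0) (r 1)| *
      triArea 0 !₂[1, 0] !₂[0, 1] := by
  let M : Matrix (Fin 2) (Fin 2) ℝ := !![q 0 - p 0, r 0 - p 0; q 1 - p 1, r 1 - p 1]
  let L : EuclideanSpace ℝ (Fin 2) →ₗ[ℝ] EuclideanSpace ℝ (Fin 2) := Matrix.toEuclideanLin M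
  have hdet : LinearMap.det L = crossDet (p 0) (p 1) (q 0) (q 1) (r 0) (r 1) := by
    simp only [L, Matrix.toEuclideanLin_eq_toLin_orthonormal, LinearMap.det_toLin, M,
      Matrix.det_fin_two_of, crossDet]
  have hq : p + L !₂[1, 0] = q := by
    ext i; fin_cases i <;> simp [L, M, Matrix.toEuclideanLin]
  have hr : p + L !₂[0, 1] = r := by
    ext i; fin_cases i <;> simp [L, M, Matrix.toEuclideanLin]
  have hhull : convexHull ℝ {p, q, r} =
      (p + ·) '' (L '' convexHull ℝ {0, !₂[1, 0], !₂[0, 1]}) := by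
    have := convexHull_vadd (𝕜 := ℝ) p (L '' {0, !₂[1, 0], !₂[0, 1]})
    rw [← L.image_convexHull] at this
    simpa only [← Set.image_vadd, vadd_eq_add, Set.image_insert_eq,
      Set.image_singleton, map_zero, add_zero, hq, hr] using this
  rw [triArea, hhull, Set.image_add_left, measure_preimage_add, Measure.addHaar_image_linearMap,
    hdet, ENNReal.toReal_mul, ENNReal.toReal_ofReal (abs_nonneg _), triArea]

lemma crossDet_combination {a₁ b₁ c₁ a₂ b₂ c₂ a₃ b₃ c₃ : ℝ}
    (h₁ : a₁ + b₁ + c₁ = 1) (h₂ : a₂ + b₂ + c₂ = 1) (h₃ : a₃ + b₃ + c₃ = 1)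
    (x₁ y₁ x₂ y₂ x₃ y₃ : ℝ) :
    crossDet (a₁ * x₁ + b₁ * x₂ + c₁ * x₃) (a₁ * y₁ + b₁ * y₂ + c₁ * y₃)
      (a₂ * x₁ + b₂ * x₂ + c₂ * x₃) (a₂ * y₁ + b₂ * y₂ + c₂ * y₃)
      (a₃ * x₁ + b₃ * x₂ + c₃ * x₃) (a₃ * y₁ + b₃ * y₂ + c₃ * y₃) =
    crossDet a₁ b₁ a₂ b₂ a₃ b₃ * crossDet x₁ y₁ x₂ y₂ x₃ y₃ := by
  obtain rfl : c₁ = 1 - a₁ - b₁ := by linarith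
  obtain rfl : c₂ = 1 - a₂ - b₂ := by linarith
  obtain rfl : c₃ = 1 - a₃ - b₃ := by linarith
  unfold crossDet
  ring

lemma abs_crossDet_le_of_box {a b l m x₁ y₁ x₂ y₂ x₃ y₃ : ℝ}
    (hx₁ : l ≤ x₁) (hx₁' : x₁ ≤ l + a) (hx₂ : l ≤ x₂) (hx₂' : x₂ ≤ l + a)
    (hx₃ : l ≤ x₃) (hx₃' : x₃ ≤ l + a) (hy₁ : m ≤ y₁) (hy₁' : y₁ ≤ m + b)
    (hy₂ : m ≤ y₂) (hy₂' : y₂ ≤ m + b) (hy₃ : m ≤ y₃) (hy₃' : y₃ ≤ m + b) :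
    |crossDet x₁ y₁ x₂ y₂ x₃ y₃| ≤ a * b := by
  have aux : ∀ {u v : ℝ}, l ≤ u → u ≤ l + a → 0 ≤ v → l * v ≤ u * v ∧ u * v ≤ (l + a) * v :=
    fun h h' hv => ⟨mul_le_mul_of_nonneg_right h hv, mul_le_mul_of_nonneg_right h' hv⟩
  have aux' : ∀ {v : ℝ}, v ≤ b → a * v ≤ a * b :=
    fun h => mul_le_mul_of_nonneg_left h (by linarith)
  unfold crossDet
  rw [abs_le]
  have h12 : y₁ - y₂ ≤ b := by linarith
  have h21 : y₂ - y₁ ≤ b := by linarith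
  have h13 : y₁ - y₃ ≤ b := by linarith
  have h31 : y₃ - y₁ ≤ b := by linarith
  have h23 : y₂ - y₃ ≤ b := by linarith
  have h32 : y₃ - y₂ ≤ b := by linarith
  have k12 := aux' h12
  have k21 := aux' h21
  have k13 := aux' h13
  have k31 := aux' h31
  have k23 := aux' h23
  have k32 := aux' h32
  rcases le_total y₁ y₂ with h | h <;> rcases le_total y₂ y₃ with h' | h' <;>
    rcases le_total y₁ y₃ with h'' | h'' <;>
    have e₁ := aux hx₃ hx₃' (sub_nonneg.2 h) <;>
    have e₂ := aux hx₁ hx₁' (sub_nonneg.2 h') <;>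
    have e₃ := aux hx₂ hx₂' (sub_nonneg.2 h'') <;>
    constructor <;> linarith

lemma abs_crossDet_le_of_corner_side_corner {x₁ y₁ z₁ x₂ y₂ z₂ x₃ y₃ z₃ : ℝ}
    (h₁ : x₁ + y₁ + z₁ = 1) (h₂ : x₂ + y₂ + z₂ = 1) (h₃ : x₃ + y₃ + z₃ = 1)
    (hx₁ : 0 ≤ x₁) (hy₁ : 3 / 5 ≤ y₁) (hz₁ : 0 ≤ z₁)
    (hx₂ : 0 ≤ x₂) (hy₂ : 2 / 5 ≤ y₂) (hz₂ : 2 / 5 ≤ z₂)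
    (hx₃ : 0 ≤ x₃) (hy₃ : 0 ≤ y₃) (hz₃ : 3 / 5 ≤ z₃) :
    |crossDet x₁ y₁ x₂ y₂ x₃ y₃| ≤ 6 / 25 := by
  unfold crossDet
  rw [abs_le]
  constructor
  · nlinarith [mul_nonneg hx₁ (sub_nonneg.2 hy₁)]
  · nlinarith

lemma abs_crossDet_le_of_mem_corner_strip {x₁ y₁ z₁ x₂ y₂ z₂ x₃ y₃ z₃ : ℝ}
    (h₁ : x₁ + y₁ + z₁ = 1) (h₂ : x₂ + y₂ + z₂ = 1) (h₃ : x₃ + y₃ + z₃ = 1)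
    (hx₁ : 3 / 5 ≤ x₁) (hy₁ : 0 ≤ y₁) (hy₁' : y₁ ≤ 1 / 5) (hz₁ : 0 ≤ z₁)
    (hx₂ : 3 / 5 ≤ x₂) (hy₂ : 0 ≤ y₂) (hy₂' : y₂ ≤ 1 / 5) (hz₂ : 0 ≤ z₂)
    (hx₃ : 0 ≤ x₃) (hy₃ : 0 ≤ y₃) (hz₃ : 3 / 5 ≤ z₃) :
    |crossDet x₁ y₁ x₂ y₂ x₃ y₃| ≤ 6 / 25 := by
  unfold crossDet
  rw [abs_le]
  constructor
  · nlinarith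
  · nlinarith
lemma abs_crossDet_le_of_two_corners {x₁ y₁ z₁ x₂ y₂ z₂ x₃ y₃ z₃ : ℝ}
    (h₁ : x₁ + y₁ + z₁ = 1) (h₂ : x₂ + y₂ + z₂ = 1) (h₃ : x₃ + y₃ + z₃ = 1)
    (hx₁ : 3 / 5 ≤ x₁) (hy₁ : 0 ≤ y₁) (hz₁ : 1 / 5 ≤ z₁)
    (hx₂ : 3 / 5 ≤ x₂) (hy₂ : 1 / 5 ≤ y₂) (hz₂ : 0 ≤ z₂)
    (hx₃ : 1 / 5 ≤ x₃) (hy₃ : 3 / 5 ≤ y₃) (hz₃ : 0 ≤ z₃) :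
    |crossDet x₁ y₁ x₂ y₂ x₃ y₃| ≤ 6 / 25 := by
  unfold crossDet
  rw [abs_le]
  constructor
  · nlinarith
  · nlinarith

section

variable {w : Fin 5 → Fin 3 → ℝ}

/-- The weights `w` describe five points all of whose triangles have area above `6 / 25`, in
every ordered pair of distinct barycentric coordinates. -/
def AllLarge (w : Fin 5 → Fin 3 → ℝ) : Prop :=
  ∀ i j : Fin 3, i ≠ j → ∀ p q r : Fin 5, p ≠ q → p ≠ r → q ≠ r →
    6 / 25 < |crossDet (w p i) (w p j) (w q i) (w q j) (w r i) (w r j)|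

lemma sum_eq_one_of_ne (hsum : ∀ p, ∑ i, w p i = 1) {i j k : Fin 3}
    (hij : i ≠ j) (hik : i ≠ k) (hjk : j ≠ k) (p : Fin 5) : w p i + w p j + w p k = 1 := by
  rw [← hsum p, Fin.sum_univ_three]
  fin_cases i <;> fin_cases j <;> fin_cases k <;> simp_all <;> ring

lemma allLarge_of_zero_one (hsum : ∀ p, ∑ i, w p i = 1)
    (h : ∀ p q r : Fin 5, p ≠ q → p ≠ r → q ≠ r →
      6 / 25 < |crossDet (w p 0) (w p 1) (w q 0) (w q 1) (w r 0) (w r 1)|) : AllLarge w := by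
  intro i j hij p q r hpq hpr hqr
  have hs : ∀ s, w s 2 = 1 - w s 0 - w s 1 := fun s => by
    have := hsum s
    rw [Fin.sum_univ_three] at this
    linarith
  refine (h p q r hpq hpr hqr).trans_eq ?_
  rw [abs_eq_abs]
  unfold crossDet
  fin_cases i <;> fin_cases j <;> simp [hs] at hij ⊢ <;>
    first | (left; ring1) | (right; ring1)

lemma AllLarge.false_of_corners (h : AllLarge w) (h0 : ∀ p i, 0 ≤ w p i)
    (hsum : ∀ p, ∑ i, w p i = 1) {i j k : Fin 3} (hij : i ≠ j) (hik : i ≠ k) (hjk : j ≠ k)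
    {p p₂ q q₂ r : Fin 5} (hp : p ≠ p₂) (hq : q ≠ q₂) (hpi : 3 / 5 ≤ w p i)
    (hpi' : 3 / 5 ≤ w p₂ i) (hqj : 3 / 5 ≤ w q j) (hqj' : 3 / 5 ≤ w q₂ j)
    (hrk : 3 / 5 ≤ w r k) : False := by
  have hs := sum_eq_one_of_ne hsum hij hik hjk
  have ne_of_corner : ∀ {s t : Fin 5} {a b : Fin 3}, a ≠ b → 3 / 5 ≤ w s a → 3 / 5 ≤ w t b →
      s ≠ t := by
    rintro s _ a b hab ha hb rfl
    have h₁ := hsum s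
    have h₂ : w s a + w s b ≤ ∑ i, w s i := by
      rw [← Finset.sum_pair hab]
      exact Finset.sum_le_univ_sum_of_nonneg (h0 s)
    linarith
  wlog hy : 1 / 5 < w p₂ j generalizing p p₂
  · refine this hp.symm hpi' hpi ?_
    by_contra! hy'
    refine (h i j hij p p₂ r hp (ne_of_corner hik hpi hrk) (ne_of_corner hik hpi' hrk)).not_ge ?_
    exact abs_crossDet_le_of_mem_corner_strip (hs p) (hs p₂) (hs r) hpi (h0 p j) hy' (h0 p k)
      hpi' (h0 p₂ j) (not_lt.1 hy) (h0 p₂ k) (h0 r i) (h0 r j) hrk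
  wlog hx : 1 / 5 < w q₂ i generalizing q q₂
  · refine this hq.symm hqj' hqj ?_
    by_contra! hx'
    refine (h j i hij.symm q q₂ r hq (ne_of_corner hjk hqj hrk)
      (ne_of_corner hjk hqj' hrk)).not_ge ?_
    exact abs_crossDet_le_of_mem_corner_strip (by linarith [hs q]) (by linarith [hs q₂])
      (by linarith [hs r]) hqj (h0 q i) hx' (h0 q k)
      hqj' (h0 q₂ i) (not_lt.1 hx) (h0 q₂ k) (h0 r j) (h0 r i) hrk
  have hpq := ne_of_corner hij hpi hqj'
  have hpq' := ne_of_corner hij hpi' hqj'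
  have hs₁ := hs p
  have hs₂ := hs p₂
  have hs₃ := hs q₂
  rcases le_total (w p k) (1 / 5) with hz | hz
  · refine (h i k hik p p₂ q₂ hp hpq hpq').not_ge ?_
    have := abs_crossDet_le_of_box (a := 1) (b := 1 / 5) (l := 0) (m := 0)
      (h0 p i) (by linarith [h0 p j, h0 p k]) (h0 p₂ i) (by linarith [h0 p₂ j, h0 p₂ k])
      (h0 q₂ i) (by linarith [h0 q₂ j, h0 q₂ k])
      (h0 p k) (by linarith) (h0 p₂ k) (by linarith) (h0 q₂ k) (by linarith)
    linarith
  · exact (h i j hij p p₂ q₂ hp hpq hpq').not_ge <| abs_crossDet_le_of_two_corners hs₁ hs₂ hs₃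
      hpi (h0 p j) hz hpi' hy.le (h0 p₂ k) hx.le hqj' (h0 q₂ k)

/-- The cells of a subdivision of the triangle: `(0, k)` is a corner, `(1, k)` is the middle part
of a side, and `(2, k)` covers part of the interior. -/
def InCell (w : Fin 3 → ℝ) : Fin 3 × Fin 3 → Prop
  | (0, k) => 3 / 5 ≤ w k
  | (1, k) => ∀ j, j ≠ k → 2 / 5 ≤ w j
  | (2, k) => w k ≤ 3 / 5 ∧ ∀ j, j ≠ k → w j ≤ 2 / 5

lemma exists_inCell (w : Fin 3 → ℝ) : ∃ c, InCell w c := by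
  by_contra! hc
  have hA := fun k => hc (0, k)
  have hB := fun k => hc (1, k)
  have hC := fun k => hc (2, k)
  simp only [InCell, not_le, not_forall, not_and, Fin.forall_fin_succ] at hA hB hC
  grind

lemma sum_card_fiber_le_two {α : Type*} [DecidableEq α] (g : Fin 5 → α) (K : Finset α)
    (hK : ∀ p q r, p ≠ q → p ≠ r → q ≠ r → g p ∈ K → g q ∈ K → g r ∈ K → False) :
    ∑ c ∈ K, (Finset.univ.filter (g · = c)).card ≤ 2 := by
  have : ∑ c ∈ K, (Finset.univ.filter (g · = c)).card =
      (Finset.univ.filter (g · ∈ K)).card := by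
    rw [Finset.card_eq_sum_card_fiberwise (f := g) (t := K) (by intro p; simp)]
    refine Finset.sum_congr rfl fun c hc => congrArg _ ?_
    ext p
    simp only [Finset.mem_filter, Finset.mem_univ, true_and]
    exact ⟨fun h => ⟨h ▸ hc, h⟩, And.right⟩
  rw [this]
  by_contra! h
  obtain ⟨p, q, r, hp, hq, hr, hpq, hpr, hqr⟩ := Finset.two_lt_card_iff.1 h
  simp only [Finset.mem_filter, Finset.mem_univ, true_and] at hp hq hr
  exact hK p q r hpq hpr hqr hp hq hr

lemma not_allLarge (h0 : ∀ p i, 0 ≤ w p i) (hsum : ∀ p, ∑ i, w p i = 1) : ¬ AllLarge w := by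
  intro h
  choose g hg using fun p => exists_inCell (w p)
  set n : Fin 3 × Fin 3 → ℕ := fun c => (Finset.univ.filter (g · = c)).card with hn
  have hpar : ∀ i j k : Fin 3, i ≠ j → i ≠ k → j ≠ k →
      n (0, k) + n (1, i) + n (2, j) + n (2, k) ≤ 2 := by
    intro i j k hij hik hjk
    have hbox : ∀ p, g p ∈ ({(0, k), (1, i), (2, j), (2, k)} : Finset (Fin 3 × Fin 3)) →
        w p i ≤ 2 / 5 ∧ w p j ≤ 3 / 5 := by
      intro p hp
      have hs := sum_eq_one_of_ne hsum hij hik hjk p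
      have hc := hg p
      simp only [Finset.mem_insert, Finset.mem_singleton] at hp
      rcases hp with hp | hp | hp | hp <;> rw [hp] at hc <;> simp only [InCell] at hc
      · constructor <;> linarith [h0 p i, h0 p j]
      · have := hc j hij.symm
        have := hc k hik.symm
        constructor <;> linarith [h0 p i, h0 p j]
      · exact ⟨hc.2 i hij, hc.1⟩
      · exact ⟨hc.2 i hik, by linarith [hc.2 j hjk]⟩
    have := sum_card_fiber_le_two g {(0, k), (1, i), (2, j), (2, k)} ?_
    · rw [Finset.sum_insert (by simp), Finset.sum_insert (by simp),
        Finset.sum_insert (by simp [hjk]), Finset.sum_singleton] at this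
      simp only [hn]
      omega
    · intro p q r hpq hpr hqr hp hq hr
      refine (h i j hij p q r hpq hpr hqr).not_ge ?_
      have := abs_crossDet_le_of_box (a := 2 / 5) (b := 3 / 5) (l := 0) (m := 0)
        (h0 p i) (by linarith [hbox p hp]) (h0 q i) (by linarith [hbox q hq])
        (h0 r i) (by linarith [hbox r hr]) (h0 p j) (by linarith [hbox p hp])
        (h0 q j) (by linarith [hbox q hq]) (h0 r j) (by linarith [hbox r hr])
      linarith
  have hside : ∀ i j k : Fin 3, i ≠ j → i ≠ k → j ≠ k → n (1, i) + n (1, j) ≤ 2 := by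
    intro i j k hij hik hjk
    have hbox : ∀ p, g p ∈ ({(1, i), (1, j)} : Finset (Fin 3 × Fin 3)) →
        w p i ≤ 3 / 5 ∧ 2 / 5 ≤ w p k ∧ w p k ≤ 3 / 5 := by
      intro p hp
      have hs := sum_eq_one_of_ne hsum hij hik hjk p
      have hc := hg p
      simp only [Finset.mem_insert, Finset.mem_singleton] at hp
      rcases hp with hp | hp <;> rw [hp] at hc <;> simp only [InCell] at hc
      · have := hc j hij.symm
        have := hc k hik.symm
        refine ⟨?_, this, ?_⟩ <;> linarith [h0 p i]
      · have := hc i hij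
        have := hc k hjk.symm
        refine ⟨?_, this, ?_⟩ <;> linarith [h0 p j]
    have := sum_card_fiber_le_two g {(1, i), (1, j)} ?_
    · rwa [Finset.sum_pair (by simp [hij])] at this
    · intro p q r hpq hpr hqr hp hq hr
      refine (h i k hik p q r hpq hpr hqr).not_ge ?_
      obtain ⟨hp₁, hp₂, hp₃⟩ := hbox p hp
      obtain ⟨hq₁, hq₂, hq₃⟩ := hbox q hq
      obtain ⟨hr₁, hr₂, hr₃⟩ := hbox r hr
      have := abs_crossDet_le_of_box (a := 3 / 5) (b := 1 / 5) (l := 0) (m := 2 / 5)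
        (h0 p i) (by linarith) (h0 q i) (by linarith) (h0 r i) (by linarith)
        hp₂ (by linarith) hq₂ (by linarith) hr₂ (by linarith)
      linarith
  have exists_of_pos : ∀ c, n c ≠ 0 → ∃ p, g p = c := by
    intro c hc
    obtain ⟨p, hp⟩ := Finset.card_ne_zero.1 hc
    exact ⟨p, by simpa using hp⟩
  have hline : ∀ i j k : Fin 3, i ≠ j → i ≠ k → j ≠ k →
      n (0, j) = 0 ∨ n (1, i) = 0 ∨ n (0, k) = 0 := by
    intro i j k hij hik hjk
    by_contra! hc
    obtain ⟨p, hp⟩ := exists_of_pos _ hc.1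
    obtain ⟨q, hq⟩ := exists_of_pos _ hc.2.1
    obtain ⟨r, hr⟩ := exists_of_pos _ hc.2.2
    have hcp := hg p
    have hcq := hg q
    have hcr := hg r
    rw [hp] at hcp
    rw [hq] at hcq
    rw [hr] at hcr
    have hs := sum_eq_one_of_ne hsum hij hik hjk
    have hpq : p ≠ q := by rintro rfl; simp [hp] at hq
    have hpr : p ≠ r := by rintro rfl; simp [hp, hjk] at hr
    have hqr : q ≠ r := by rintro rfl; simp [hq] at hr
    exact (h i j hij p q r hpq hpr hqr).not_ge <| abs_crossDet_le_of_corner_side_corner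
      (hs p) (hs q) (hs r) (h0 p i) hcp (h0 p k) (h0 q i) (hcq j hij.symm) (hcq k hik.symm)
      (h0 r i) (h0 r j) hcr
  have hcorner : ∀ i j k : Fin 3, i ≠ j → i ≠ k → j ≠ k →
      ¬ (1 < n (0, i) ∧ 1 < n (0, j) ∧ n (0, k) ≠ 0) := by
    rintro i j k hij hik hjk ⟨hi, hj, hk⟩
    obtain ⟨p, p₂, hp, hp', hpp⟩ := Finset.one_lt_card_iff.1 hi
    obtain ⟨q, q₂, hq, hq', hqq⟩ := Finset.one_lt_card_iff.1 hj
    obtain ⟨r, hr⟩ := exists_of_pos _ hk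
    simp only [Finset.mem_filter, Finset.mem_univ, true_and] at hp hp' hq hq'
    have cornerMem : ∀ {s l}, g s = (0, l) → 3 / 5 ≤ w s l := fun {s l} hs => by
      have := hg s
      rwa [hs] at this
    exact h.false_of_corners h0 hsum hij hik hjk hpp hqq (cornerMem hp) (cornerMem hp')
      (cornerMem hq) (cornerMem hq') (cornerMem hr)
  have htotal : ∑ c, n c = 5 := by
    simpa using (Finset.card_eq_sum_card_fiberwise (f := g) (s := Finset.univ)
      (t := Finset.univ) (by simp)).symm
  rw [Fintype.sum_prod_type] at htotal
  simp only [Fin.sum_univ_three] at htotal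
  have a₁ := hpar 0 1 2 (by decide) (by decide) (by decide)
  have a₂ := hpar 0 2 1 (by decide) (by decide) (by decide)
  have a₃ := hpar 1 0 2 (by decide) (by decide) (by decide)
  have a₄ := hpar 1 2 0 (by decide) (by decide) (by decide)
  have a₅ := hpar 2 0 1 (by decide) (by decide) (by decide)
  have a₆ := hpar 2 1 0 (by decide) (by decide) (by decide)
  have b₁ := hside 0 1 2 (by decide) (by decide) (by decide)
  have b₂ := hside 0 2 1 (by decide) (by decide) (by decide)
  have b₃ := hside 1 2 0 (by decide) (by decide) (by decide)
  have c₁ := hline 0 1 2 (by decide) (by decide) (by decide)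
  have c₂ := hline 1 0 2 (by decide) (by decide) (by decide)
  have c₃ := hline 2 0 1 (by decide) (by decide) (by decide)
  have d₁ := hcorner 0 1 2 (by decide) (by decide) (by decide)
  have d₂ := hcorner 0 2 1 (by decide) (by decide) (by decide)
  have d₃ := hcorner 1 2 0 (by decide) (by decide) (by decide)
  omega

end

lemma exists_weights_of_mem_convexHull {E : Type*} [AddCommGroup E] [Module ℝ E] {A B C p : E}
    (hp : p ∈ convexHull ℝ ({A, B, C} : Set E)) :
    ∃ w : Fin 3 → ℝ, (∀ i, 0 ≤ w i) ∧ ∑ i, w i = 1 ∧ p = w 0 • A + w 1 • B + w 2 • C := by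
  rw [convexHull_insert (by simp), convexHull_pair, convexJoin_singleton_left] at hp
  simp only [Set.mem_iUnion] at hp
  obtain ⟨q, ⟨b, c, hb, hc, hbc, rfl⟩, a, d, ha, hd, had, rfl⟩ := hp
  refine ⟨![a, d * b, d * c], ?_, ?_, ?_⟩
  · intro i
    fin_cases i <;> simp <;> positivity
  · simp only [Fin.sum_univ_three, Matrix.cons_val]
    linear_combination had + d * hbc
  · simp [smul_add, mul_smul, add_assoc]

theorem stmt_1 (A B C : EuclideanSpace ℝ (Fin 2)) (hABC : triArea A B C = 1)
    (p : Fin 5 → EuclideanSpace ℝ (Fin 2))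
    (hp : ∀ i, p i ∈ convexHull ℝ ({A, B, C} : Set (EuclideanSpace ℝ (Fin 2)))) :
    ∃ i j k : Fin 5, i ≠ j ∧ i ≠ k ∧ j ≠ k ∧ triArea (p i) (p j) (p k) ≤ 6 / 25 := by
  choose w h0 hsum hw using fun i => exists_weights_of_mem_convexHull (hp i)
  have hs : ∀ s, w s 0 + w s 1 + w s 2 = 1 := fun s => by rw [← hsum s, Fin.sum_univ_three]
  by_contra! hlarge
  refine not_allLarge h0 hsum (allLarge_of_zero_one hsum fun i j k hij hik hjk => ?_)
  refine (hlarge i j k hij hik hjk).trans_eq ?_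
  rw [triArea_eq_abs_crossDet_mul] at hABC ⊢
  simp only [hw, PiLp.add_apply, PiLp.smul_apply, smul_eq_mul]
  rw [crossDet_combination (hs i) (hs j) (hs k), abs_mul, mul_assoc, hABC, mul_one]
end
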